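/- Let 𝒰 be a selective ultrafilter on ω and ℋ a stable ordered-union ultrafilter on FIN with 𝒰 ∈ 𝒞₁(ℋ). Then Player I does not have a winning strategy in the selectivity-stability game Γ^SelStab(𝒰, ℋ). -/

import Mathlib

open Set Filter

abbrev FIN : Type := {s : Finset ℕ // s.Nonempty}

def maxF (s : FIN) : ℕ := s.1.max' s.2

def minF (s : FIN) : ℕ := s.1.min' s.2

/-- `s <_b t` iff `max s < min t`. -/
def blt (s t : FIN) : Prop := maxF s < minF t

/-- An infinite block sequence, presented as its increasing enumeration. -/
def IsBlockFun (X : ℕ → FIN) : Prop := ∀ i j : ℕ, i < j → blt (X i) (X j)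

/-- A block sequence of length `n`. -/
def IsBlockSeqN {n : ℕ} (X : Fin n → FIN) : Prop :=
  ∀ i j : Fin n, i < j → blt (X i) (X j)

/-- `[X]` : all unions of finitely many (at least one) members of `X`. -/
def blocks (X : ℕ → FIN) : Set FIN :=
  {s | ∃ F : Finset ℕ, F.Nonempty ∧ s.1 = F.sup fun i => (X i).1}

def IsOrderedUnion (H : Ultrafilter FIN) : Prop :=
  ∀ A : Set FIN, A ∈ H →
    ∃ X : ℕ → FIN, IsBlockFun X ∧ blocks X ∈ H ∧ blocks X ⊆ A

def IsStableOU (H : Ultrafilter FIN) : Prop :=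
  IsOrderedUnion H ∧
    ∀ Xs : ℕ → ℕ → FIN, (∀ n, IsBlockFun (Xs n) ∧ blocks (Xs n) ∈ H) →
      ∃ Y : ℕ → FIN, IsBlockFun Y ∧ blocks Y ∈ H ∧
        ∀ n, ∀ᶠ i in atTop, Y i ∈ blocks (Xs n)

def IsSelective (U : Ultrafilter ℕ) : Prop :=
  ∀ f : ℕ → ℕ, ∃ A : Set ℕ, A ∈ U ∧
    ((∀ x ∈ A, ∀ y ∈ A, f x = f y) ∨ Set.InjOn f A)

/-- `I(s) = {k : min s ≤ k ≤ max s}`. -/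
def Iset (s : FIN) : Set ℕ := Set.Icc (minF s) (maxF s)

/-- `N(X) = ⋃ i, I(X(i))`. -/
def Nset (X : ℕ → FIN) : Set ℕ := ⋃ i, Iset (X i)

/-- Membership in the class `𝒞₀(ℋ)`. -/
def MemC0 (H : Ultrafilter FIN) (U : Ultrafilter ℕ) : Prop :=
  IsSelective U ∧
    ∀ X : ℕ → FIN, IsBlockFun X → blocks X ∈ H →
      ∃ Y : ℕ → FIN, IsBlockFun Y ∧ blocks Y ∈ H ∧ blocks Y ⊆ blocks X ∧
        Nset Y ∉ U

def RKle (U V : Ultrafilter ℕ) : Prop := ∃ f : ℕ → ℕ, Ultrafilter.map f V = U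

def RKequiv (U V : Ultrafilter ℕ) : Prop := RKle U V ∧ RKle V U

/-- Membership in the class `𝒞₁(ℋ)`. -/
def MemC1 (H : Ultrafilter FIN) (U : Ultrafilter ℕ) : Prop :=
  IsSelective U ∧
    ∀ V : Ultrafilter ℕ, IsSelective V → ¬ MemC0 H V → ¬ RKequiv U V

def initSeg {α : Type _} (f : ℕ → α) (n : ℕ) : List α := (List.range n).map f

def interleave (a : ℕ → ℕ) (b : ℕ → FIN) (m : ℕ) : ℕ ⊕ FIN :=
  if m % 2 = 0 then Sum.inl (a (m / 2)) else Sum.inr (b (m / 2))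

/-- Nodes of the tree `𝕋`: a node of length `l` is a sequence whose `k`-th entry
codes a function `𝒫(k) → 2` (coded as a total function `Finset ℕ → Bool`;
only values on subsets of `{0,…,k−1}` matter). -/
abbrev Node : Type := List (Finset ℕ → Bool)

/-- `s⁻ = s \ {max s}`. -/
def sm (s : FIN) : Finset ℕ := s.1.erase (maxF s)

/-- `A` is `(k,s)`-big. -/
def IsBig (k : ℕ) (s : FIN) (A : Set (Finset ℕ → Bool)) : Prop :=
  ∀ σ : Finset ℕ → Bool, ∃ τ ∈ A, ∀ u ⊆ Finset.range k, σ u = τ (u ∪ sm s)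

def succT (T : Set Node) (f : Node) : Set (Finset ℕ → Bool) := {τ | f ++ [τ] ∈ T}

/-- `H_{p,k}`. -/
def Hset (T : Set Node) (k : ℕ) : Set FIN :=
  {s | k ≤ maxF s ∧ ∀ f ∈ T, f.length = maxF s → IsBig k s (succT T f)}

/-- `T` is an `ℋ`-condition, i.e. a member of `ℙ(ℋ)`. -/
def IsCond (H : Ultrafilter FIN) (T : Set Node) : Prop :=
  (∀ g ∈ T, ∀ n, g.take n ∈ T) ∧ ([] : Node) ∈ T ∧
    (∀ f ∈ T, ∀ n : ℕ, f.length ≤ n → ∃ g ∈ T, f <+: g ∧ n ≤ g.length) ∧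
    ∀ k : ℕ, Hset T k ∈ H

/-- `T⟨f⟩`. -/
def Tsub (T : Set Node) (f : Node) : Set Node := {g ∈ T | f <+: g ∨ g <+: f}

/-- The constraint linking consecutive moves of Player I in `Γ^Cond(ℋ)`. -/
def StepOK (H : Ultrafilter FIN) (p : Set Node) (s : FIN) (p' : Set Node) : Prop :=
  ∃ q : Node → Set Node,
    (∀ e ∈ p, e.length = maxF s + 1 → IsCond H (q e) ∧ q e ⊆ Tsub p e) ∧
    p' = ⋃ e ∈ {e : Node | e ∈ p ∧ e.length = maxF s + 1}, q e

lemma minF_le' {s : FIN} {x : ℕ} (h : x ∈ s.1) : minF s ≤ x := Finset.min'_le _ _ h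
lemma le_maxF' {s : FIN} {x : ℕ} (h : x ∈ s.1) : x ≤ maxF s := Finset.le_max' _ _ h
lemma minF_mem' (s : FIN) : minF s ∈ s.1 := Finset.min'_mem _ _
lemma maxF_mem' (s : FIN) : maxF s ∈ s.1 := Finset.max'_mem _ _
lemma minF_le_maxF' (s : FIN) : minF s ≤ maxF s := minF_le' (maxF_mem' s)

lemma block_ge {X : ℕ → FIN} (hX : IsBlockFun X) (i : ℕ) : i ≤ minF (X i) := by
  induction i with
  | zero => exact Nat.zero_le _
  | succ k ih =>
    have := hX k (k+1) (Nat.lt_succ_self k)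
    have h2 := minF_le_maxF' (X k)
    unfold blt at this
    omega

lemma self_mem_blocks (X : ℕ → FIN) (i : ℕ) : X i ∈ blocks X :=
  ⟨{i}, Finset.singleton_nonempty i, by simp⟩

lemma blocks_of_parts {X Y : ℕ → FIN} {s : FIN} {F : Finset ℕ} (hF : F.Nonempty)
    (hs : s.1 = F.sup fun i => (Y i).1) (h : ∀ i ∈ F, Y i ∈ blocks X) : s ∈ blocks X := by
  classical
  have h' : ∀ i, ∃ G : Finset ℕ, i ∈ F → (G.Nonempty ∧ (Y i).1 = G.sup fun i => (X i).1) := by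
    intro i
    by_cases hi : i ∈ F
    · obtain ⟨G, hG⟩ := h i hi
      exact ⟨G, fun _ => hG⟩
    · exact ⟨∅, fun h => absurd h hi⟩
  choose G hG using h'
  refine ⟨F.biUnion G, ?_, ?_⟩
  · obtain ⟨i, hi⟩ := hF
    obtain ⟨x, hx⟩ := (hG i hi).1
    exact ⟨x, Finset.mem_biUnion.2 ⟨i, hi, hx⟩⟩
  · rw [hs, Finset.sup_biUnion]
    exact Finset.sup_congr rfl fun i hi => (hG i hi).2

lemma blocks_mono' {X Y : ℕ → FIN} (h : ∀ i, Y i ∈ blocks X) : blocks Y ⊆ blocks X := by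
  rintro s ⟨F, hF, hs⟩
  exact blocks_of_parts hF hs fun i _ => h i

def unionF (s t : FIN) : FIN := ⟨s.1 ∪ t.1, s.2.mono Finset.subset_union_left⟩

lemma union_mem_blocks {X : ℕ → FIN} {s t : FIN} (hs : s ∈ blocks X) (ht : t ∈ blocks X) :
    unionF s t ∈ blocks X := by
  classical
  obtain ⟨F, hF, hs⟩ := hs
  obtain ⟨G, hG, ht⟩ := ht
  refine ⟨F ∪ G, hF.mono Finset.subset_union_left, ?_⟩
  rw [Finset.sup_union, ← hs, ← ht]
  rfl

lemma maxF_unionF {s t : FIN} (h : blt s t) : maxF (unionF s t) = maxF t := by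
  apply le_antisymm
  · rcases Finset.mem_union.1 (maxF_mem' (unionF s t)) with h1 | h1
    · have := le_maxF' h1
      have := minF_le_maxF' t
      unfold blt at h; omega
    · exact le_maxF' h1
  · exact le_maxF' (Finset.mem_union_right _ (maxF_mem' t))

lemma minF_unionF {s t : FIN} (h : blt s t) : minF (unionF s t) = minF s := by
  apply le_antisymm
  · exact minF_le' (Finset.mem_union_left _ (minF_mem' s))
  · rcases Finset.mem_union.1 (minF_mem' (unionF s t)) with h1 | h1
    · exact minF_le' h1
    · have := minF_le' h1
      have := minF_le_maxF' s
      unfold blt at h; omega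

/-- the first and last parts -/
lemma exists_min_part {X : ℕ → FIN} (hX : IsBlockFun X) {s : FIN} (hs : s ∈ blocks X) :
    ∃ i, minF s = minF (X i) := by
  obtain ⟨F, hF, hs⟩ := hs
  refine ⟨F.min' hF, le_antisymm ?_ ?_⟩
  · apply minF_le'
    rw [hs, Finset.mem_sup]
    exact ⟨_, Finset.min'_mem _ hF, minF_mem' _⟩
  · have := minF_mem' s
    rw [hs, Finset.mem_sup] at this
    obtain ⟨j, hj, hj2⟩ := this
    rcases (Finset.min'_le F j hj).eq_or_lt with h | h
    · rw [h]; exact minF_le' hj2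
    · have h1 := hX _ _ h
      have h2 := minF_le' hj2
      have := minF_le_maxF' (X (F.min' hF))
      unfold blt at h1; omega

lemma exists_max_part {X : ℕ → FIN} (hX : IsBlockFun X) {s : FIN} (hs : s ∈ blocks X) :
    ∃ i, maxF s = maxF (X i) := by
  obtain ⟨F, hF, hs⟩ := hs
  refine ⟨F.max' hF, le_antisymm ?_ ?_⟩
  · have := maxF_mem' s
    rw [hs, Finset.mem_sup] at this
    obtain ⟨j, hj, hj2⟩ := this
    rcases (Finset.le_max' F j hj).eq_or_lt with h | h
    · rw [← h]; exact le_maxF' hj2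
    · have h1 := hX _ _ h
      have h2 := le_maxF' hj2
      have := minF_le_maxF' (X (F.max' hF))
      unfold blt at h1; omega
  · apply le_maxF'
    rw [hs, Finset.mem_sup]
    exact ⟨_, Finset.max'_mem _ hF, maxF_mem' _⟩

lemma mem_of_hits {H : Ultrafilter FIN} (hH : IsOrderedUnion H) {P : Set FIN}
    (h : ∀ X : ℕ → FIN, IsBlockFun X → ∃ s ∈ blocks X, s ∈ P) : P ∈ H := by
  by_contra hP
  obtain ⟨X, hX, -, hsub⟩ := hH _ (Ultrafilter.compl_mem_iff_notMem.2 hP)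
  obtain ⟨s, hs, hsP⟩ := h X hX
  exact hsub hs hsP

lemma tail_mem {H : Ultrafilter FIN} (hH : IsOrderedUnion H) (n : ℕ) : {s | n ≤ minF s} ∈ H :=
  mem_of_hits hH fun X hX => ⟨X n, self_mem_blocks X n, block_ge hX n⟩

lemma stab_diag {H : Ultrafilter FIN} (hH : IsStableOU H) (A : ℕ → Set FIN) (hA : ∀ k, A k ∈ H) :
    ∃ Y : ℕ → FIN, IsBlockFun Y ∧ blocks Y ∈ H ∧
      ∀ k, ∃ N, ∀ s ∈ blocks Y, N ≤ minF s → s ∈ A k := by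
  choose Xs h1 h2 h3 using fun k => hH.1 (A k) (hA k)
  obtain ⟨Y, hY, hYH, hall⟩ := hH.2 Xs fun n => ⟨h1 n, h2 n⟩
  refine ⟨Y, hY, hYH, fun k => ?_⟩
  obtain ⟨N, hN⟩ := eventually_atTop.1 (hall k)
  refine ⟨maxF (Y N) + 1, ?_⟩
  rintro s ⟨F, hF, hs⟩ hmin
  refine h3 k (blocks_of_parts hF hs fun i hi => hN i ?_)
  by_contra hlt
  push Not at hlt
  have h4 := hY _ _ hlt
  have h5 : minF s ≤ minF (Y i) := by
    apply minF_le'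
    rw [hs, Finset.mem_sup]
    exact ⟨i, hi, minF_mem' _⟩
  have := minF_le_maxF' (Y N)
  unfold blt at h4
  have := minF_le_maxF' (Y i)
  omega

def cnt (κ : ℕ → ℕ) (s : FIN) : ℕ :=
  (s.1.filter fun a => ∃ b ∈ s.1, a < b ∧ κ b ≤ κ a + 2).card

lemma cnt_union {κ : ℕ → ℕ} (hκ : Monotone κ) {s t : FIN} (h : blt s t) :
    cnt κ (unionF s t) = cnt κ s + cnt κ t + (if κ (minF t) ≤ κ (maxF s) + 2 then 1 else 0) := by
  classical
  have hst : ∀ a ∈ s.1, ∀ b ∈ t.1, a < b := by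
    intro a ha b hb
    have := le_maxF' ha
    have := minF_le' hb
    unfold blt at h; omega
  unfold cnt
  have hd : Disjoint s.1 t.1 := by
    rw [Finset.disjoint_left]
    intro a ha hb
    exact lt_irrefl _ (hst a ha a hb)
  have e1 : (unionF s t).1.filter (fun a => ∃ b ∈ (unionF s t).1, a < b ∧ κ b ≤ κ a + 2)
      = (s.1.filter fun a => ∃ b ∈ (unionF s t).1, a < b ∧ κ b ≤ κ a + 2) ∪
        (t.1.filter fun a => ∃ b ∈ (unionF s t).1, a < b ∧ κ b ≤ κ a + 2) :=
    Finset.filter_union _ _ _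
  have e2 : (t.1.filter fun a => ∃ b ∈ (unionF s t).1, a < b ∧ κ b ≤ κ a + 2)
      = t.1.filter fun a => ∃ b ∈ t.1, a < b ∧ κ b ≤ κ a + 2 := by
    apply Finset.filter_congr
    intro a ha
    constructor
    · rintro ⟨b, hb, hab, hk⟩
      rcases Finset.mem_union.1 hb with hb | hb
      · have := hst b hb a ha; omega
      · exact ⟨b, hb, hab, hk⟩
    · rintro ⟨b, hb, hab, hk⟩
      exact ⟨b, Finset.mem_union_right _ hb, hab, hk⟩
  have e3 : (s.1.filter fun a => ∃ b ∈ (unionF s t).1, a < b ∧ κ b ≤ κ a + 2)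
      = (s.1.filter fun a => ∃ b ∈ s.1, a < b ∧ κ b ≤ κ a + 2) ∪
        (if κ (minF t) ≤ κ (maxF s) + 2 then {maxF s} else ∅) := by
    ext a
    simp only [Finset.mem_filter, Finset.mem_union]
    constructor
    · rintro ⟨ha, b, hb, hab, hk⟩
      by_cases hm : a = maxF s
      · right
        rcases Finset.mem_union.1 hb with hb | hb
        · have := le_maxF' hb; omega
        · have := hκ (minF_le' hb)
          rw [if_pos (by rw [← hm]; omega)]
          simp [hm]
      · left
        have h1 := le_maxF' ha
        rcases Finset.mem_union.1 hb with hb | hb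
        · exact ⟨ha, b, hb, hab, hk⟩
        · refine ⟨ha, maxF s, maxF_mem' s, by omega, ?_⟩
          have := hκ (hst _ (maxF_mem' s) b hb).le
          omega
    · rintro (⟨ha, b, hb, hab, hk⟩ | h1)
      · exact ⟨ha, b, Finset.mem_union_left _ hb, hab, hk⟩
      · split_ifs at h1 with hc
        · rw [Finset.mem_singleton] at h1
          subst h1
          exact ⟨maxF_mem' s, minF t, Finset.mem_union_right _ (minF_mem' t), h, hc⟩
        · simp at h1
  have d3 : Disjoint (s.1.filter fun a => ∃ b ∈ s.1, a < b ∧ κ b ≤ κ a + 2)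
        (if κ (minF t) ≤ κ (maxF s) + 2 then {maxF s} else ∅) := by
    split_ifs
    · rw [Finset.disjoint_singleton_right, Finset.mem_filter]
      rintro ⟨_, b, hb, hab, _⟩
      have := le_maxF' hb; omega
    · simp
  rw [e1, Finset.card_union_of_disjoint, e2, e3, Finset.card_union_of_disjoint d3]
  · split_ifs <;> simp <;> omega
  · exact Finset.disjoint_filter_filter hd

lemma gap_set {H : Ultrafilter FIN} (hH : IsOrderedUnion H) {κ : ℕ → ℕ} (hκ : Monotone κ)
    (hinf : ∀ k, ∃ n, k ≤ κ n) :
    ∃ G ∈ H, ∀ s ∈ G, ∀ t ∈ G, blt s t → κ (maxF s) + 2 < κ (minF t) := by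
  rcases Ultrafilter.mem_or_compl_mem H {s | cnt κ s % 2 = 0} with h | h
  · obtain ⟨X, hX, hXH, hsub⟩ := hH _ h
    refine ⟨_, hXH, fun s hs t ht hst => ?_⟩
    have h1 := hsub hs
    have h2 := hsub ht
    have h3 := hsub (union_mem_blocks hs ht)
    simp only [mem_ofPred_eq] at h1 h2 h3
    rw [cnt_union hκ hst] at h3
    split_ifs at h3 <;> omega
  · exfalso
    obtain ⟨X, hX, hXH, hsub⟩ := hH _ h
    obtain ⟨n, hn⟩ := hinf (κ (maxF (X 0)) + 3)
    have hn2 := hκ (block_ge hX n)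
    have hn3 := hκ (minF_le_maxF' (X 0))
    have hpos : 0 < n := by
      rcases Nat.eq_zero_or_pos n with h0 | h0
      · subst h0; omega
      · exact h0
    have hst := hX 0 n hpos
    have h1 := hsub (self_mem_blocks X 0)
    have h2 := hsub (self_mem_blocks X n)
    have h3 := hsub (union_mem_blocks (self_mem_blocks X 0) (self_mem_blocks X n))
    simp only [mem_compl_iff, mem_ofPred_eq] at h1 h2 h3
    rw [cnt_union hκ hst] at h3
    split_ifs at h3 <;> omega

lemma setup (R : ℕ → ℕ → Prop) (hR : ∀ x, ∃ y0, ∀ y ≥ y0, R x y) :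
    ∃ (m κ : ℕ → ℕ), StrictMono m ∧ Monotone κ ∧ (∀ n, m (κ n) ≤ n) ∧ (∀ n, n < m (κ n + 1)) ∧
      (∀ k, κ (m k) = k) ∧ ∀ k, R (m k) (m (k+1)) := by
  choose y hy using hR
  obtain ⟨m, hm0, hms⟩ : ∃ m : ℕ → ℕ, m 0 = 0 ∧ ∀ k, m (k+1) = y (m k) + m k + 1 :=
    ⟨fun k => Nat.rec 0 (fun _ x => y x + x + 1) k, rfl, fun k => rfl⟩
  have hm : StrictMono m := strictMono_nat_of_lt_succ fun k => by rw [hms]; omega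
  have hex : ∀ n, ∃ k, n < m (k+1) := fun n => ⟨n, by have := hm.id_le (n+1); simp at this; omega⟩
  classical
  let κ : ℕ → ℕ := fun n => Nat.find (hex n)
  have h1 : ∀ n, n < m (κ n + 1) := fun n => Nat.find_spec (hex n)
  have h2 : ∀ n, m (κ n) ≤ n := by
    intro n
    rcases Nat.eq_zero_or_pos (κ n) with h | h
    · rw [h, hm0]; exact Nat.zero_le n
    · have := Nat.find_min (hex n) (m := κ n - 1) (show κ n - 1 < κ n by omega)
      rw [Nat.sub_add_cancel h] at this
      omega
  refine ⟨m, κ, hm, ?_, h2, h1, ?_, ?_⟩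
  · intro a b hab
    have := hm.lt_iff_lt.1 (lt_of_le_of_lt (h2 a) (lt_of_le_of_lt hab (h1 b)))
    omega
  · intro k
    have a1 := hm.le_iff_le.1 (h2 (m k))
    have a2 := hm.lt_iff_lt.1 (h1 (m k))
    omega
  · intro k
    apply hy
    rw [hms]; omega

lemma sep {U : Ultrafilter ℕ} {H : Ultrafilter FIN} (hC1 : MemC1 H U) (f : ℕ → ℕ)
    (hf : ∀ A ∈ U, ∃ x ∈ A, ∃ y ∈ A, f x ≠ f y) (g : FIN → ℕ) (X : ℕ → FIN) (hX : IsBlockFun X)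
    (hXH : blocks X ∈ H)
    (hg : ∀ Y : ℕ → FIN, IsBlockFun Y → blocks Y ⊆ blocks X → ∀ s ∈ blocks Y, g s ∈ Nset Y) :
    ¬ (∀ R : Set ℕ, f ⁻¹' R ∈ U ↔ g ⁻¹' R ∈ H) := by
  intro heq
  obtain ⟨A, hA, hinj⟩ : ∃ A ∈ U, Set.InjOn f A := by
    obtain ⟨A, hA, h | h⟩ := hC1.1 f
    · obtain ⟨x, hx, y, hy, hxy⟩ := hf A hA
      exact absurd (h x hx y hy) hxy
    · exact ⟨A, hA, h⟩
  refine hC1.2 (U.map f) ?_ ?_ ?_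
  · intro k
    obtain ⟨B, hB, h⟩ := hC1.1 (k ∘ f)
    refine ⟨f '' B, ?_, ?_⟩
    · show f ⁻¹' _ ∈ U
      exact Filter.mem_of_superset hB (Set.subset_preimage_image f B)
    · rcases h with h | h
      · left
        rintro _ ⟨x, hx, rfl⟩ _ ⟨y, hy, rfl⟩
        exact h x hx y hy
      · right
        rintro _ ⟨x, hx, rfl⟩ _ ⟨y, hy, rfl⟩ hxy
        rw [h hx hy hxy]
  · rintro ⟨-, h⟩
    obtain ⟨Y, hY, hYH, hsub, hN⟩ := h X hX hXH
    apply hN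
    show f ⁻¹' _ ∈ U
    rw [heq]
    exact Filter.mem_of_superset hYH (hg Y hY hsub)
  · refine ⟨⟨Function.invFunOn f A, ?_⟩, ⟨f, rfl⟩⟩
    rw [Ultrafilter.map_map]
    apply Ultrafilter.coe_injective
    rw [Ultrafilter.coe_map]
    have : (Function.invFunOn f A ∘ f) =ᶠ[(U : Filter ℕ)] id := by
      filter_upwards [hA] with x hx
      exact hinj.leftInvOn_invFunOn hx
    rw [Filter.map_congr this, Filter.map_id]

lemma sep2 {U : Ultrafilter ℕ} {H : Ultrafilter FIN} (hC1 : MemC1 H U)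
    (hfin : ∀ F : Set ℕ, F.Finite → F ∉ U)
    {m κ : ℕ → ℕ} (hm : StrictMono m) (h2 : ∀ n, n < m (κ n + 1)) (μ : FIN → ℕ) (o : ℕ)
    (X : ℕ → FIN) (hX : IsBlockFun X) (hXH : blocks X ∈ H)
    (hg : ∀ Y : ℕ → FIN, IsBlockFun Y → blocks Y ⊆ blocks X →
      ∀ s ∈ blocks Y, m (μ s + o) ∈ Nset Y) (p q : ℕ) :
    ∃ C ∈ U, ∃ G ∈ H, ∀ n ∈ C, ∀ s ∈ G, κ n + p ≠ μ s + q := by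
  by_contra hcon
  have key : ∀ R : Set ℕ, (fun n => κ n + p) ⁻¹' R ∈ U ↔ (fun s => μ s + q) ⁻¹' R ∈ H := by
    intro R
    constructor
    · intro h
      by_contra h'
      refine hcon ⟨_, h, _, Ultrafilter.compl_mem_iff_notMem.2 h', ?_⟩
      intro n hn s hs he
      apply hs
      show μ s + q ∈ R
      rw [← he]; exact hn
    · intro h
      by_contra h'
      refine hcon ⟨_, Ultrafilter.compl_mem_iff_notMem.2 h', _, h, ?_⟩
      intro n hn s hs he
      apply hn
      show κ n + p ∈ R
      rw [he]; exact hs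
  refine sep hC1 (fun n => m (κ n + p - q + o)) ?_ (fun s => m (μ s + o)) X hX hXH hg ?_
  · intro A hA
    obtain ⟨x, hx⟩ := Ultrafilter.nonempty_of_mem hA
    by_contra hne
    push Not at hne
    refine hfin A ?_ hA
    apply (Set.finite_Iio (m (κ x + p - q + o + q + 1))).subset
    intro y hy
    have := hm.injective (hne x hx y hy)
    have h3 := h2 y
    have : m (κ y + 1) ≤ m (κ x + p - q + o + q + 1) := hm.monotone (by omega)
    exact lt_of_lt_of_le h3 this
  · intro R
    have := key {r | m (r - q + o) ∈ R}
    have e1 : ∀ s, μ s + q - q + o = μ s + o := fun s => by omega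
    have e2 : (fun s => m (μ s + o)) ⁻¹' R = (fun s => μ s + q) ⁻¹' {r | m (r - q + o) ∈ R} := by
      ext s
      show m (μ s + o) ∈ R ↔ m (μ s + q - q + o) ∈ R
      rw [e1]
    rw [e2]
    exact this

lemma core {U : Ultrafilter ℕ} {H : Ultrafilter FIN} (hH : IsStableOU H) (hC1 : MemC1 H U)
    (hfin : ∀ F : Set ℕ, F.Finite → F ∉ U)
    (B : ℕ → Set ℕ) (hB : ∀ k, B k ∈ U) (hBa : Antitone B)
    (A : ℕ → Set FIN) (hA : ∀ k, A k ∈ H) (hAa : Antitone A) :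
    ∃ E : Set (ℕ × FIN), (∀ p ∈ E, p.1 < minF p.2 ∧ p.2 ∈ A p.1 ∧ p.1 ∈ B 0) ∧
      (∀ p ∈ E, ∀ q ∈ E, p ≠ q → (maxF p.2 < q.1 ∧ q.1 ∈ B (maxF p.2)) ∨
        (maxF q.2 < p.1 ∧ p.1 ∈ B (maxF q.2))) ∧
      Prod.fst '' E ∈ U ∧ ∃ Z : ℕ → FIN, IsBlockFun Z ∧ blocks Z ∈ H ∧ ∀ i, Z i ∈ Prod.snd '' E := by
  classical
  have htail : ∀ k, Set.Ici k ∈ U := by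
    intro k
    rw [← Ultrafilter.compl_notMem_iff]
    apply hfin
    rw [Set.compl_Ici]; exact Set.finite_Iio k
  -- step 1
  obtain ⟨C0, hC0, hC0B⟩ : ∃ C0 ∈ U, ∀ k, ∃ N, ∀ n ∈ C0, N ≤ n → n ∈ B k := by
    have hex : ∀ n, ∃ k, n ∉ B k ∩ Set.Ici k := fun n => ⟨n+1, fun h => by
      have := h.2; simp at this⟩
    obtain ⟨C, hC, h | h⟩ := hC1.1 (fun n => Nat.find (hex n))
    · exfalso
      obtain ⟨x, hx⟩ := Ultrafilter.nonempty_of_mem hC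
      obtain ⟨y, hy⟩ := Ultrafilter.nonempty_of_mem
        (Filter.inter_mem hC (Filter.inter_mem (hB (Nat.find (hex x))) (htail (Nat.find (hex x)))))
      have h1 := h x hx y hy.1
      have h2 := Nat.find_spec (hex y)
      rw [← h1] at h2
      exact h2 hy.2
    · refine ⟨C, hC, fun k => ?_⟩
      have hf : {n ∈ C | Nat.find (hex n) ≤ k}.Finite := by
        apply Set.Finite.of_finite_image (f := fun n => Nat.find (hex n))
        · apply (Set.finite_Iic k).subset
          rintro _ ⟨n, hn, rfl⟩
          exact hn.2
        · exact h.mono fun n hn => hn.1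
      obtain ⟨N, hN⟩ := hf.bddAbove
      refine ⟨N+1, fun n hn hle => ?_⟩
      have h3 : ¬ Nat.find (hex n) ≤ k := fun h => by
        have := hN ⟨hn, h⟩; omega
      have := Nat.find_min (hex n) (not_le.1 h3)
      rw [not_not] at this
      exact this.1
  obtain ⟨Y0, hY0, hY0H, hY0A⟩ := stab_diag hH A hA
  -- step 3
  obtain ⟨m, κ, hm, hκ, hk1, hk2, hk3, hR⟩ := setup (fun x y =>
    (∀ n ∈ C0, y ≤ n → n ∈ B x) ∧ (∀ s ∈ blocks Y0, y ≤ minF s → s ∈ A x) ∧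
    (∃ n ∈ B x, x ≤ n ∧ n < y) ∧ (∃ s ∈ A x, x ≤ minF s ∧ maxF s < y)) (by
      intro x
      obtain ⟨N1, hN1⟩ := hC0B x
      obtain ⟨N2, hN2⟩ := hY0A x
      obtain ⟨n, hn, hn2⟩ := Ultrafilter.nonempty_of_mem (Filter.inter_mem (hB x) (htail x))
      obtain ⟨s, hs, hs2⟩ := Ultrafilter.nonempty_of_mem
        (Filter.inter_mem (hA x) (tail_mem hH.1 x))
      have hn2' : x ≤ n := hn2
      have hs2' : x ≤ minF s := hs2
      refine ⟨N1 + N2 + n + maxF s + 1, fun y hy => ⟨?_, ?_, ?_, ?_⟩⟩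
      · intro k hk hyk; exact hN1 k hk (by omega)
      · intro k hk hyk; exact hN2 k hk (by omega)
      · exact ⟨n, hn, hn2', by omega⟩
      · exact ⟨s, hs, hs2', by omega⟩)
  choose hRn hRs hfn hfs using hR
  choose fn hfnB hfn1 hfn2 using hfn
  choose fs hfsA hfs1 hfs2 using hfs
  have hinf : ∀ k, ∃ n, k ≤ κ n := fun k => ⟨m k, (hk3 k).ge⟩
  obtain ⟨G, hGH, hG⟩ := gap_set hH.1 hκ hinf
  have hD : {s | κ (minF s) < κ (maxF s)} ∈ H := by
    apply mem_of_hits hH.1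
    intro X hX
    have h0 : blt (X 0) (X (m (κ (minF (X 0)) + 1))) := by
      apply hX
      exact lt_of_le_of_lt (Nat.zero_le _) (hk2 (minF (X 0)))
    refine ⟨_, union_mem_blocks (self_mem_blocks X 0)
      (self_mem_blocks X (m (κ (minF (X 0)) + 1))), ?_⟩
    show κ _ < κ _
    rw [minF_unionF h0, maxF_unionF h0]
    have h1 := hκ ((block_ge hX (m (κ (minF (X 0)) + 1))).trans (minF_le_maxF' _))
    rw [hk3] at h1
    omega
  obtain ⟨X0, hX0, hX0H, hX0D⟩ := hH.1 _ hD
  have sepmin := sep2 hC1 hfin hm hk2 (fun s => κ (minF s)) 1 X0 hX0 hX0H (by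
    intro Y hY hsub s hs
    obtain ⟨i, hi⟩ := exists_min_part hY hs
    have hd : κ (minF (Y i)) < κ (maxF (Y i)) := hX0D (hsub (self_mem_blocks Y i))
    refine Set.mem_iUnion.2 ⟨i, ?_, ?_⟩
    · show _ ≤ m (κ (minF s) + 1)
      rw [hi]; exact (hk2 _).le
    · show m (κ (minF s) + 1) ≤ _
      rw [hi]; exact (hm.monotone (by omega)).trans (hk1 _))
  have sepmax := sep2 hC1 hfin hm hk2 (fun s => κ (maxF s)) 0 X0 hX0 hX0H (by
    intro Y hY hsub s hs
    obtain ⟨i, hi⟩ := exists_max_part hY hs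
    have hd : κ (minF (Y i)) < κ (maxF (Y i)) := hX0D (hsub (self_mem_blocks Y i))
    refine Set.mem_iUnion.2 ⟨i, ?_, ?_⟩
    · show _ ≤ m (κ (maxF s) + 0)
      rw [hi]; exact (hk2 _).le.trans (hm.monotone (by omega))
    · show m (κ (maxF s) + 0) ≤ _
      rw [hi]; exact hk1 _)
  choose C1 hC1U G1 hG1H hsep1 using sepmin 3
  choose C2 hC2U G2 hG2H hsep2 using sepmax 3
  have hCi : (⋂ e ∈ Finset.range 7, (C1 e ∩ C2 e)) ∈ U :=
    (Filter.biInter_finset_mem _).2 fun e _ => Filter.inter_mem (hC1U e) (hC2U e)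
  have hGi : (⋂ e ∈ Finset.range 7, (G1 e ∩ G2 e)) ∈ H :=
    (Filter.biInter_finset_mem _).2 fun e _ => Filter.inter_mem (hG1H e) (hG2H e)
  obtain ⟨X, hX, hXH, hXsub⟩ := hH.1 _ (Filter.inter_mem hGi (Filter.inter_mem hGH
    (Filter.inter_mem hY0H (tail_mem hH.1 (m 2)))))
  have hUC0 : MemC0 H U := by
    by_contra h
    exact hC1.2 U hC1.1 h ⟨⟨id, Ultrafilter.map_id U⟩, ⟨id, Ultrafilter.map_id U⟩⟩
  obtain ⟨Z, hZ, hZH, hZX, hZN⟩ := hUC0.2 X hX hXH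
  obtain ⟨C3, hC3U, hinj⟩ : ∃ C ∈ U, Set.InjOn κ C := by
    obtain ⟨C, hC, h | h⟩ := hC1.1 κ
    · exfalso
      obtain ⟨x, hx⟩ := Ultrafilter.nonempty_of_mem hC
      refine hfin C ((Set.finite_Iio (m (κ x + 1))).subset ?_) hC
      intro y hy
      rw [h x hx y hy]; exact hk2 y
    · exact ⟨C, hC, h⟩
  obtain ⟨C4, hC4U, r, hr⟩ : ∃ C ∈ U, ∃ r, ∀ n ∈ C, κ n % 3 = r := by
    rcases Ultrafilter.mem_or_compl_mem U {n | κ n % 3 = 0} with h | h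
    · exact ⟨_, h, 0, fun n hn => hn⟩
    · rcases Ultrafilter.mem_or_compl_mem U {n | κ n % 3 = 1} with h' | h'
      · exact ⟨_, h', 1, fun n hn => hn⟩
      · refine ⟨_, Filter.inter_mem h h', 2, fun n hn => ?_⟩
        have h1 : ¬ (κ n % 3 = 0) := hn.1
        have h2 : ¬ (κ n % 3 = 1) := hn.2
        omega
  obtain ⟨C, hCdef⟩ : ∃ C, C = (⋂ e ∈ Finset.range 7, (C1 e ∩ C2 e)) ∩ (C3 ∩ (C4 ∩ (C0 ∩
    (Set.Ici (m 1) ∩ (Nset Z)ᶜ)))) := ⟨_, rfl⟩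
  have hCU : C ∈ U := by
    rw [hCdef]
    exact Filter.inter_mem hCi (Filter.inter_mem hC3U (Filter.inter_mem hC4U (Filter.inter_mem hC0
      (Filter.inter_mem (htail _) (Ultrafilter.compl_mem_iff_notMem.2 hZN)))))
  -- facts
  have Zpos : ∀ i, 2 ≤ κ (minF (Z i)) := by
    intro i
    have := hκ (hXsub (hZX (self_mem_blocks Z i))).2.2.2
    rwa [hk3] at this
  have Cpos : ∀ n ∈ C, 1 ≤ κ n := by
    intro n hn
    rw [hCdef] at hn
    have := hκ hn.2.2.2.2.1
    rwa [hk3] at this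
  have CC : ∀ n ∈ C, ∀ n' ∈ C, n ≠ n' → κ n + 3 ≤ κ n' ∨ κ n' + 3 ≤ κ n := by
    intro n hn n' hn' hne
    rw [hCdef] at hn hn'
    have h1 := hr n hn.2.2.1
    have h2 := hr n' hn'.2.2.1
    have h3 : κ n ≠ κ n' := fun h => hne (hinj hn.2.1 hn'.2.1 h)
    omega
  have ZZ : ∀ i j, i < j → κ (maxF (Z i)) + 2 < κ (minF (Z j)) := by
    intro i j hij
    exact hG _ (hXsub (hZX (self_mem_blocks Z i))).2.1 _ (hXsub (hZX (self_mem_blocks Z j))).2.1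
      (hZ i j hij)
  have CZ : ∀ n ∈ C, ∀ i, κ n + 4 ≤ κ (minF (Z i)) ∨ κ (maxF (Z i)) + 4 ≤ κ n := by
    intro n hn i
    rw [hCdef] at hn
    have hs := (hXsub (hZX (self_mem_blocks Z i))).1
    have h1 := hn.1
    have hn3 := hn.2.2.2.2.2
    simp only [Set.mem_iInter] at h1 hs
    have a1 : ∀ e ∈ Finset.range 7, κ n + 3 ≠ κ (minF (Z i)) + e :=
      fun e he => hsep1 e n (h1 e he).1 _ (hs e he).1
    have a2 : ∀ e ∈ Finset.range 7, κ n + 3 ≠ κ (maxF (Z i)) + e :=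
      fun e he => hsep2 e n (h1 e he).2 _ (hs e he).2
    have a3 : ¬ (minF (Z i) ≤ n ∧ n ≤ maxF (Z i)) := by
      intro h
      exact hn3 (Set.mem_iUnion.2 ⟨i, h⟩)
    by_cases hlt : n < minF (Z i)
    · left
      have := hκ hlt.le
      by_contra hc
      exact a1 (κ n + 3 - κ (minF (Z i))) (Finset.mem_range.2 (by omega)) (by omega)
    · right
      have hlt : maxF (Z i) < n := by omega
      have := hκ hlt.le
      by_contra hc
      exact a2 (κ n + 3 - κ (maxF (Z i))) (Finset.mem_range.2 (by omega)) (by omega)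
  have CB : ∀ n ∈ C, n ∈ B (m (κ n - 1)) := by
    intro n hn
    have hp := Cpos n hn
    rw [hCdef] at hn
    refine hRn (κ n - 1) n hn.2.2.2.1 ?_
    rw [Nat.sub_add_cancel hp]; exact hk1 n
  have ZA : ∀ i, Z i ∈ A (m (κ (minF (Z i)) - 1)) := by
    intro i
    have hp := Zpos i
    refine hRs (κ (minF (Z i)) - 1) _ (hXsub (hZX (self_mem_blocks Z i))).2.2.1 ?_
    rw [Nat.sub_add_cancel (by omega)]; exact hk1 _
  -- the events
  let ev : C ⊕ ℕ → ℕ × FIN := fun x => match x with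
    | Sum.inl n => (n.1, fs (κ n.1 + 1))
    | Sum.inr i => (fn (κ (minF (Z i)) - 2), Z i)
  let lo : C ⊕ ℕ → ℕ := fun x => match x with
    | Sum.inl n => κ n.1 - 1
    | Sum.inr i => κ (minF (Z i)) - 2
  let hi : C ⊕ ℕ → ℕ := fun x => match x with
    | Sum.inl n => κ n.1 + 2
    | Sum.inr i => κ (maxF (Z i)) + 1
  have evlo : ∀ x, m (lo x) ≤ (ev x).1 := by
    rintro (n | i)
    · exact (hm.monotone (Nat.sub_le _ _)).trans (hk1 n.1)
    · exact hfn1 _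
  have evB : ∀ x, (ev x).1 ∈ B (m (lo x)) := by
    rintro (n | i)
    · exact CB n.1 n.2
    · exact hfnB _
  have evhi : ∀ x, maxF (ev x).2 < m (hi x) := by
    rintro (n | i)
    · exact hfs2 _
    · exact hk2 _
  have evlt : ∀ x, (ev x).1 < minF (ev x).2 ∧ (ev x).2 ∈ A (ev x).1 := by
    rintro (n | i)
    · exact ⟨(hk2 n.1).trans_le (hfs1 _), hAa (hk2 n.1).le (hfsA _)⟩
    · have h1 : fn (κ (minF (Z i)) - 2) < m (κ (minF (Z i)) - 1) := by
        have := hfn2 (κ (minF (Z i)) - 2)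
        have hp := Zpos i
        rwa [show κ (minF (Z i)) - 2 + 1 = κ (minF (Z i)) - 1 by omega] at this
      exact ⟨h1.trans_le ((hm.monotone (Nat.sub_le _ _)).trans (hk1 _)), hAa h1.le (ZA i)⟩
  have evsep : ∀ x y, x ≠ y → hi x ≤ lo y ∨ hi y ≤ lo x := by
    rintro (n | i) (n' | j) hne
    · have := CC n.1 n.2 n'.1 n'.2 (fun h => hne (by rw [Subtype.ext h]))
      show κ n.1 + 2 ≤ κ n'.1 - 1 ∨ κ n'.1 + 2 ≤ κ n.1 - 1
      omega
    · have := CZ n.1 n.2 j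
      show κ n.1 + 2 ≤ κ (minF (Z j)) - 2 ∨ κ (maxF (Z j)) + 1 ≤ κ n.1 - 1
      omega
    · have := CZ n'.1 n'.2 i
      show κ (maxF (Z i)) + 1 ≤ κ n'.1 - 1 ∨ κ n'.1 + 2 ≤ κ (minF (Z i)) - 2
      omega
    · have hij : i ≠ j := fun h => hne (by rw [h])
      show κ (maxF (Z i)) + 1 ≤ κ (minF (Z j)) - 2 ∨ κ (maxF (Z j)) + 1 ≤ κ (minF (Z i)) - 2
      rcases lt_or_gt_of_ne hij with h | h
      · have := ZZ i j h; omega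
      · have := ZZ j i h; omega
  have evord : ∀ x y, hi x ≤ lo y → maxF (ev x).2 < (ev y).1 ∧ (ev y).1 ∈ B (maxF (ev x).2) := by
    intro x y h
    have h1 := (evhi x).trans_le (hm.monotone h)
    exact ⟨h1.trans_le (evlo y), hBa h1.le (evB y)⟩
  refine ⟨Set.range ev, ?_, ?_, ?_, Z, hZ, hZH, ?_⟩
  · rintro _ ⟨x, rfl⟩
    exact ⟨(evlt x).1, (evlt x).2, hBa (Nat.zero_le _) (evB x)⟩
  · rintro _ ⟨x, rfl⟩ _ ⟨y, rfl⟩ hne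
    rcases evsep x y (fun h => hne (by rw [h])) with h | h
    · exact Or.inl (evord x y h)
    · exact Or.inr (evord y x h)
  · refine Filter.mem_of_superset hCU ?_
    intro n hn
    exact ⟨_, ⟨Sum.inl ⟨n, hn⟩, rfl⟩, rfl⟩
  · intro i
    exact ⟨_, ⟨Sum.inr i, rfl⟩, rfl⟩

lemma assembly {U : Ultrafilter ℕ} {H : Ultrafilter FIN} (hH : IsStableOU H) (hC1 : MemC1 H U)
    (hfin : ∀ F : Set ℕ, F.Finite → F ∉ U)
    (B : ℕ → Set ℕ) (hB : ∀ k, B k ∈ U) (hBa : Antitone B)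
    (A : ℕ → Set FIN) (hA : ∀ k, A k ∈ H) (hAa : Antitone A) :
    ∃ (a : ℕ → ℕ) (b : ℕ → FIN), (∀ i, a i < minF (b i)) ∧ (∀ i, maxF (b i) < a (i+1)) ∧
      a 0 ∈ B 0 ∧ (∀ i, a (i+1) ∈ B (maxF (b i))) ∧ (∀ i, b i ∈ A (a i)) ∧
      Set.range a ∈ U ∧ IsBlockFun b ∧ blocks b ∈ H := by
  classical
  obtain ⟨E, hE1, hE2, hEU, Z, hZ, hZH, hZE⟩ := core hH hC1 hfin B hB hBa A hA hAa
  have hS : (Prod.fst '' E).Infinite := fun h => hfin _ h hEU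
  obtain ⟨a, ha⟩ : ∃ a, a = Nat.nth (· ∈ Prod.fst '' E) := ⟨_, rfl⟩
  have hmono : StrictMono a := by rw [ha]; exact Nat.nth_strictMono hS
  have hrange : Set.range a = Prod.fst '' E := by
    rw [ha]
    exact Nat.range_nth_of_infinite (p := (· ∈ Prod.fst '' E)) hS
  have hmem : ∀ i, ∃ s, (a i, s) ∈ E := by
    intro i
    have : a i ∈ Prod.fst '' E := by rw [← hrange]; exact ⟨i, rfl⟩
    obtain ⟨⟨x, s⟩, h, h2⟩ := this
    exact ⟨s, by rw [← h2]; exact h⟩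
  choose b hb using hmem
  have h1 : ∀ i, a i < minF (b i) := fun i => (hE1 _ (hb i)).1
  have hord : ∀ i j, i < j → maxF (b i) < a j ∧ a j ∈ B (maxF (b i)) := by
    intro i j hij
    have hlt := hmono hij
    rcases hE2 _ (hb i) _ (hb j) (fun h => by
      have := congrArg Prod.fst h; simp at this; omega) with h | h
    · exact h
    · exfalso
      have h3 := h.1
      have := h1 j
      have := minF_le_maxF' (b j)
      simp only at h3
      omega
  refine ⟨a, b, h1, fun i => (hord i _ (Nat.lt_succ_self i)).1, (hE1 _ (hb 0)).2.2,
    fun i => (hord i _ (Nat.lt_succ_self i)).2, fun i => (hE1 _ (hb i)).2.1, ?_, ?_, ?_⟩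
  · rw [hrange]; exact hEU
  · intro i j hij
    have := (hord i j hij).1
    have := h1 j
    unfold blt; omega
  · refine Filter.mem_of_superset hZH (blocks_mono' fun i => ?_)
    obtain ⟨⟨n, s⟩, hp, hp2⟩ := hZE i
    have : n ∈ Set.range a := by rw [hrange]; exact ⟨_, hp, rfl⟩
    obtain ⟨j, rfl⟩ := this
    have hs : b j = s := by
      by_contra hne
      have hq := h1 j
      have hq2 := minF_le_maxF' (b j)
      have hq3 := (hE1 _ hp).1
      have hq4 := minF_le_maxF' s
      simp only at hq3
      rcases hE2 _ (hb j) _ hp (fun h => hne (congrArg Prod.snd h)) with h | h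
      · have := h.1; simp only at this; omega
      · have := h.1; simp only at this; omega
    rw [← hp2, ← hs]
    exact self_mem_blocks b j

lemma assemblyP {H : Ultrafilter FIN} (hH : IsStableOU H)
    (A : ℕ → Set FIN) (hA : ∀ k, A k ∈ H) (hAa : Antitone A) :
    ∃ (b : ℕ → FIN), b 0 ∈ A 0 ∧ (∀ i, b (i+1) ∈ A (maxF (b i))) ∧
      IsBlockFun b ∧ blocks b ∈ H := by
  obtain ⟨Y0, hY0, hY0H, hY0A⟩ := stab_diag hH A hA
  obtain ⟨m, κ, hm, hκ, hk1, hk2, hk3, hR⟩ := setup (fun x y =>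
    (∀ s ∈ blocks Y0, y ≤ minF s → s ∈ A x)) (by
      intro x
      obtain ⟨N2, hN2⟩ := hY0A x
      exact ⟨N2, fun y hy k hk hyk => hN2 k hk (by omega)⟩)
  have hinf : ∀ k, ∃ n, k ≤ κ n := fun k => ⟨m k, (hk3 k).ge⟩
  obtain ⟨G, hGH, hG⟩ := gap_set hH.1 hκ hinf
  obtain ⟨Z, hZ, hZH, hZX⟩ := hH.1 _ (Filter.inter_mem hGH
    (Filter.inter_mem hY0H (hA 0)))
  refine ⟨Z, (hZX (self_mem_blocks Z 0)).2.2, fun i => ?_, hZ, hZH⟩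
  have hg := hG _ (hZX (self_mem_blocks Z i)).1 _ (hZX (self_mem_blocks Z (i+1))).1
    (hZ i (i+1) (Nat.lt_succ_self i))
  have h1 := hR (κ (minF (Z (i+1))) - 1) _ (hZX (self_mem_blocks Z (i+1))).2.1 (by
    rw [Nat.sub_add_cancel (by omega)]; exact hk1 _)
  refine hAa ?_ h1
  exact (hk2 _).le.trans (hm.monotone (by omega))

/-- weight of a move -/
def wt : ℕ ⊕ FIN → ℕ
  | Sum.inl n => n
  | Sum.inr s => maxF s

def LL (c k : ℕ) : Set (List (ℕ ⊕ FIN)) := {h | h.length ≤ 2 * k + 3 ∧ ∀ x ∈ h, wt x ≤ k + c}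

lemma wt_finite (k : ℕ) : {x : ℕ ⊕ FIN | wt x ≤ k}.Finite := by
  have h1 : (Sum.inl '' Set.Iic k : Set (ℕ ⊕ FIN)).Finite := (Set.finite_Iic k).image _
  have h2 : {s : FIN | maxF s ≤ k}.Finite := by
    apply Set.Finite.of_finite_image (f := Subtype.val)
    · apply (Finset.finite_toSet (Finset.range (k+1)).powerset).subset
      rintro _ ⟨s, hs, rfl⟩
      simp only [Finset.coe_powerset, Set.mem_preimage, Set.mem_powerset_iff]
      intro x hx
      have := le_maxF' hx
      have hs' : maxF s ≤ k := hs
      simp; omega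
    · exact Subtype.val_injective.injOn
  refine (h1.union (h2.image Sum.inr)).subset ?_
  rintro (n | s) hx
  · exact Or.inl ⟨n, hx, rfl⟩
  · exact Or.inr ⟨s, hx, rfl⟩

lemma lists_finite {α : Type} (F : Set α) (hF : F.Finite) (l : ℕ) :
    {h : List α | h.length ≤ l ∧ ∀ x ∈ h, x ∈ F}.Finite := by
  induction l with
  | zero =>
    apply (Set.finite_singleton ([] : List α)).subset
    rintro h ⟨h1, -⟩
    exact List.length_eq_zero_iff.1 (by omega)
  | succ l ih =>
    apply ((Set.finite_singleton ([] : List α)).union (Set.Finite.image2 List.cons hF ih)).subset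
    rintro (_ | ⟨x, t⟩) ⟨h1, h2⟩
    · exact Or.inl rfl
    · refine Or.inr ⟨x, h2 x (by simp), t, ⟨by simpa using h1, fun y hy => h2 y (by simp [hy])⟩, rfl⟩

lemma LL_finite (c k : ℕ) : (LL c k).Finite := lists_finite _ (wt_finite (k + c)) (2 * k + 3)

lemma LL_mono (c : ℕ) : Monotone (LL c) := by
  rintro j k hjk h ⟨h1, h2⟩
  exact ⟨by omega, fun x hx => by have := h2 x hx; omega⟩

lemma initSeg_mem (a : ℕ → ℕ) (b : ℕ → FIN) (c k l : ℕ) (hl : l ≤ 2 * k + 3)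
    (ha : ∀ i, 2 * i < l → a i ≤ k + c) (hb : ∀ i, 2 * i + 1 < l → maxF (b i) ≤ k + c) :
    initSeg (interleave a b) l ∈ LL c k := by
  refine ⟨by simpa [initSeg] using hl, ?_⟩
  intro x hx
  simp only [initSeg, List.mem_map, List.mem_range] at hx
  obtain ⟨j, hj, rfl⟩ := hx
  unfold interleave
  split_ifs with h
  · exact ha _ (by omega)
  · exact hb _ (by omega)

/-- if `𝒰 ∈ 𝒞₁(ℋ)` then Player I has no winning strategy in the
selectivity-stability game `Γ^SelStab(𝒰,ℋ)`.  Player I's strategy is coded by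
two functions giving its move (a member of `𝒰` at even stages, a member of `ℋ`
at odd stages) as a function of the history of Player II's previous moves. -/
theorem stmt6 (U : Ultrafilter ℕ) (H : Ultrafilter FIN)
    (hU : IsSelective U) (hH : IsStableOU H) (hC1 : MemC1 H U) :
    ¬ ∃ (StB : List (ℕ ⊕ FIN) → Set ℕ) (StA : List (ℕ ⊕ FIN) → Set FIN),
        (∀ h, StB h ∈ U) ∧ (∀ h, StA h ∈ H) ∧
        ∀ (a : ℕ → ℕ) (b : ℕ → FIN),
          (∀ i, a i ∈ StB (initSeg (interleave a b) (2 * i))) →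
          (∀ i, b i ∈ StA (initSeg (interleave a b) (2 * i + 1))) →
          ¬ (Set.range a ∈ U ∧ IsBlockFun b ∧ blocks b ∈ H) := by
  rintro ⟨StB, StA, hB, hA, hwin⟩
  have hBm : ∀ c k, (⋂ h ∈ LL c k, StB h) ∈ U := fun c k =>
    (Filter.biInter_mem (LL_finite c k)).2 fun h _ => hB h
  have hAm : ∀ c k, (⋂ h ∈ LL c k, StA h) ∈ H := fun c k =>
    (Filter.biInter_mem (LL_finite c k)).2 fun h _ => hA h
  have hBa : ∀ c, Antitone fun k => ⋂ h ∈ LL c k, StB h := fun c j k hjk =>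
    Set.biInter_subset_biInter_left (LL_mono c hjk)
  have hAa : ∀ c, Antitone fun k => ⋂ h ∈ LL c k, StA h := fun c j k hjk =>
    Set.biInter_subset_biInter_left (LL_mono c hjk)
  by_cases hfin : ∀ F : Set ℕ, F.Finite → F ∉ U
  · obtain ⟨a, b, h1, h2, h3, h4, h5, h6, h7, h8⟩ := assembly hH hC1 hfin _ (hBm 0) (hBa 0) _
      (hAm 0) (hAa 0)
    have hab : ∀ i, a i ≤ maxF (b i) := fun i => (h1 i).le.trans (minF_le_maxF' _)
    have hamono : StrictMono a := strictMono_nat_of_lt_succ fun i => (hab i).trans_lt (h2 i)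
    have hbm : Monotone fun i => maxF (b i) :=
      monotone_nat_of_le_succ fun i => (h2 i).le.trans (hab _)
    have hai : ∀ i, i ≤ a i := fun i => hamono.le_apply
    refine hwin a b ?_ ?_ ⟨h6, h7, h8⟩
    · rintro (_ | i)
      · exact Set.mem_iInter₂.1 h3 _ (initSeg_mem a b 0 0 _ (by omega) (by omega) (by omega))
      · refine Set.mem_iInter₂.1 (h4 i) _ (initSeg_mem a b 0 _ _ ?_ ?_ ?_)
        · have := hab i; have := hai i; omega
        · intro j hj
          exact (hab j).trans (hbm (show j ≤ i by omega))
        · intro j hj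
          exact (hbm (show j ≤ i by omega))
    · intro i
      refine Set.mem_iInter₂.1 (h5 i) _ (initSeg_mem a b 0 _ _ ?_ ?_ ?_)
      · have := hai i; omega
      · intro j hj
        exact hamono.monotone (show j ≤ i by omega)
      · intro j hj
        exact (h2 j).le.trans (hamono.monotone (show j + 1 ≤ i by omega))
  · push Not at hfin
    obtain ⟨F, hF, hFU⟩ := hfin
    obtain ⟨c, -, rfl⟩ := Ultrafilter.eq_pure_of_finite_mem hF hFU
    obtain ⟨b, h1, h2, h3, h4⟩ := assemblyP hH _ (hAm c) (hAa c)
    have hbm : Monotone fun i => maxF (b i) :=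
      monotone_nat_of_le_succ fun i =>
        (le_of_lt (h3 i (i+1) (Nat.lt_succ_self i))).trans (minF_le_maxF' _)
    refine hwin (fun _ => c) b ?_ ?_ ⟨?_, h3, h4⟩
    · intro i
      exact Ultrafilter.mem_pure.1 (hB _)
    · rintro (_ | i)
      · exact Set.mem_iInter₂.1 h1 _ (initSeg_mem _ b c 0 _ (by omega) (by simp) (by omega))
      · refine Set.mem_iInter₂.1 (h2 i) _ (initSeg_mem _ b c _ _ ?_ ?_ ?_)
        · have := block_ge h3 i; have := minF_le_maxF' (b i); omega
        · intro j hj; omega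
        · intro j hj
          exact (hbm (show j ≤ i by omega)).trans (Nat.le_add_right _ _)
    · exact Ultrafilter.mem_pure.2 ⟨0, rfl⟩
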